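/- arXiv:1911.01743 — 3 statements merged into one kernel-verified Lean document; each statement's English description precedes it below -/
import Mathlib

section
/- Inclusion-exclusion polynomials determine their defining data: if ρ₁ and ρ₂ are finite sets of pairwise coprime integers greater than 1, and the associated inclusion-exclusion polynomials satisfy Q_{ρ₁}(x) = Q_{ρ₂}(x), then ρ₁ = ρ₂. -/
open Polynomial Finset

/-- The finset of unitary divisors of `n`: divisors `d` of `n` with `gcd (d, n / d) = 1`. -/
def unitaryDivisors (n : ℕ) : Finset ℕ :=
  n.divisors.filter fun d => Nat.Coprime d (n / d)

/-- `d ∣∣ n`: `d` is a unitary divisor of `n`. -/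
def IsUnitaryDivisor (d n : ℕ) : Prop := d ∈ unitaryDivisors n

/-- `(j, n)_*`: the greatest `d` such that `d ∣ j` and `d` is a unitary divisor of `n`. -/
def unitaryGcd (j n : ℕ) : ℕ :=
  ((unitaryDivisors n).filter fun d => d ∣ j).sup id

/-- `κ(n)`: the squarefree kernel (radical) of `n`. -/
def kernel (n : ℕ) : ℕ := ∏ p ∈ n.primeFactors, p

/-- `φ*(n)`: the unitary Euler totient function. -/
def unitaryTotient (n : ℕ) : ℕ :=
  ((Finset.Icc 1 n).filter fun j => unitaryGcd j n = 1).card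

/-- `μ*(n) = (-1)^{ω(n)}`: the unitary Moebius function. -/
def unitaryMoebius (n : ℕ) : ℤ := (-1) ^ n.primeFactors.card

/-- `Φ*_n`: the unitary cyclotomic polynomial (over `ℂ`). -/
noncomputable def unitaryCyclotomic (n : ℕ) : Polynomial ℂ :=
  ∏ j ∈ (Finset.Icc 1 n).filter fun j => unitaryGcd j n = 1,
    (X - C (Complex.exp (2 * (Real.pi : ℂ) * Complex.I * (j : ℂ) / (n : ℂ))))

/-- `c*_n(k)`: the unitary Ramanujan sum. -/
noncomputable def unitaryRamanujan (n k : ℕ) : ℂ :=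
  ∑ j ∈ (Finset.Icc 1 n).filter fun j => unitaryGcd j n = 1,
    Complex.exp (2 * (Real.pi : ℂ) * Complex.I * (j : ℂ) * (k : ℂ) / (n : ℂ))

/-- `c_n(k)`: the classical Ramanujan sum. -/
noncomputable def ramanujanSum (n k : ℕ) : ℂ :=
  ∑ j ∈ (Finset.Icc 1 n).filter fun j => Nat.Coprime j n,
    Complex.exp (2 * (Real.pi : ℂ) * Complex.I * (j : ℂ) * (k : ℂ) / (n : ℂ))

/-- The unitary convolution `(f × g)(n) = ∑_{d ∣∣ n} f(d) g(n/d)`. -/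
noncomputable def unitaryConv (f g : ℕ → ℂ) (n : ℕ) : ℂ :=
  ∑ d ∈ unitaryDivisors n, f d * g (n / d)

/-- `Λ*(n)`: the unitary von Mangoldt function, `a log p` for `n = p^a`, else `0`. -/
noncomputable def unitaryVonMangoldt (n : ℕ) : ℝ :=
  if IsPrimePow n then (n.factorization n.minFac : ℝ) * Real.log n.minFac else 0
/-- `ρ` is a valid data set for an inclusion-exclusion polynomial: a finite set of
pairwise coprime integers all greater than `1`. -/
def IsIEData (ρ : Finset ℕ) : Prop :=
  (∀ r ∈ ρ, 1 < r) ∧ (∀ r ∈ ρ, ∀ s ∈ ρ, r ≠ s → Nat.Coprime r s)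

/-- `Q` is the inclusion-exclusion polynomial `Q_ρ`, i.e. it satisfies the defining
rational-function identity
`Q_ρ(x) · ∏_{S ⊆ ρ, |S| odd} (x^{n₀/∏_{r ∈ S} r} - 1) = ∏_{S ⊆ ρ, |S| even} (x^{n₀/∏_{r ∈ S} r} - 1)`
where `n₀ = ∏_{r ∈ ρ} r`. -/
def IsIEPoly (ρ : Finset ℕ) (Q : Polynomial ℤ) : Prop :=
  Q * ∏ S ∈ ρ.powerset.filter fun S => Odd S.card,
        ((X : Polynomial ℤ) ^ ((∏ r ∈ ρ, r) / ∏ r ∈ S, r) - 1) =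
    ∏ S ∈ ρ.powerset.filter fun S => Even S.card,
      ((X : Polynomial ℤ) ^ ((∏ r ∈ ρ, r) / ∏ r ∈ S, r) - 1)

theorem exists_ge_of_prod_X_pow_sub_one_eq {M N : Multiset ℕ} (hM : ∀ n ∈ M, 0 < n)
    (hN : ∀ n ∈ N, 0 < n)
    (h : (M.map fun n => (X : ℤ[X]) ^ n - 1).prod = (N.map fun n => (X : ℤ[X]) ^ n - 1).prod)
    {m : ℕ} (hm : m ∈ M) : ∃ n ∈ N, m ≤ n := by
  have hζ := Complex.isPrimitiveRoot_exp m (hM m hm).ne'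
  set ζ := Complex.exp (2 * Real.pi * Complex.I / m)
  have h0 : aeval ζ (M.map fun n => (X : ℤ[X]) ^ n - 1).prod = 0 := by
    rw [map_multiset_prod, Multiset.map_map]
    exact Multiset.prod_eq_zero (Multiset.mem_map.2 ⟨m, hm, by simp [hζ.pow_eq_one]⟩)
  rw [h, map_multiset_prod, Multiset.map_map, Multiset.prod_eq_zero_iff, Multiset.mem_map] at h0
  obtain ⟨n, hn, hn0⟩ := h0
  refine ⟨n, hn, Nat.le_of_dvd (hN n hn) (hζ.dvd_of_pow_eq_one n ?_)⟩
  simpa [sub_eq_zero] using hn0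

/-- A product of polynomials `X ^ n - 1` with positive `n` determines the exponents. -/
theorem multiset_eq_of_prod_X_pow_sub_one_eq {M N : Multiset ℕ} (hM : ∀ n ∈ M, 0 < n)
    (hN : ∀ n ∈ N, 0 < n)
    (h : (M.map fun n => (X : ℤ[X]) ^ n - 1).prod = (N.map fun n => (X : ℤ[X]) ^ n - 1).prod) :
    M = N := by
  induction hk : M.card generalizing M N with
  | zero =>
    obtain rfl := Multiset.card_eq_zero.1 hk
    refine (Multiset.eq_zero_of_forall_notMem fun n hn => ?_).symm
    obtain ⟨_, hm, _⟩ := exists_ge_of_prod_X_pow_sub_one_eq hN hM h.symm hn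
    simp at hm
  | succ k ih =>
    have hne : M.toFinset.Nonempty := by
      rw [Multiset.toFinset_nonempty]
      rintro rfl
      simp at hk
    obtain ⟨m, hm, hmax⟩ := M.toFinset.exists_max_image id hne
    simp only [Multiset.mem_toFinset, id] at hm hmax
    obtain ⟨n, hn, hmn⟩ := exists_ge_of_prod_X_pow_sub_one_eq hM hN h hm
    obtain ⟨m', hm', hnm⟩ := exists_ge_of_prod_X_pow_sub_one_eq hN hM h.symm hn
    obtain rfl : m = n := hmn.antisymm (hnm.trans (hmax m' hm'))
    obtain ⟨M, rfl⟩ := Multiset.exists_cons_of_mem hm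
    obtain ⟨N, rfl⟩ := Multiset.exists_cons_of_mem hn
    simp only [Multiset.map_cons, Multiset.prod_cons, Multiset.card_cons] at h hk
    rw [ih (fun n hn => hM n (Multiset.mem_cons_of_mem hn))
      (fun n hn => hN n (Multiset.mem_cons_of_mem hn))
      (mul_left_cancel₀ (X_pow_sub_C_ne_zero (hM m hm) 1) (by simpa using h)) (by omega)]

namespace IsIEData

theorem prod_pos {ρ S : Finset ℕ} (hρ : IsIEData ρ) (hS : S ⊆ ρ) : 0 < ∏ r ∈ S, r :=
  Finset.prod_pos fun r hr => zero_lt_one.trans (hρ.1 r (hS hr))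

theorem prod_div {ρ S : Finset ℕ} (hρ : IsIEData ρ) (hS : S ⊆ ρ) :
    (∏ r ∈ ρ, r) / ∏ r ∈ S, r = ∏ r ∈ ρ \ S, r := by
  rw [← prod_sdiff hS, Nat.mul_div_cancel _ (hρ.prod_pos hS)]

theorem mem_of_dvd_prod {ρ S : Finset ℕ} (hρ : IsIEData ρ) (hS : S ⊆ ρ) {r : ℕ} (hr : r ∈ ρ)
    (h : r ∣ ∏ s ∈ S, s) : r ∈ S := by
  by_contra hrS
  have hcop : Nat.Coprime r (∏ s ∈ S, s) :=
    Nat.Coprime.prod_right fun s hs => hρ.2 r hr s (hS hs) (by rintro rfl; exact hrS hs)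
  exact (hρ.1 r hr).ne' (hcop.eq_one_of_dvd h)

theorem eq_of_prod_eq {ρ S T : Finset ℕ} (hρ : IsIEData ρ) (hS : S ⊆ ρ) (hT : T ⊆ ρ)
    (h : ∏ r ∈ S, r = ∏ r ∈ T, r) : S = T :=
  Subset.antisymm (fun _ hr => hρ.mem_of_dvd_prod hT (hS hr) (h ▸ dvd_prod_of_mem _ hr))
    (fun _ hr => hρ.mem_of_dvd_prod hS (hT hr) (h ▸ dvd_prod_of_mem _ hr))

theorem subset_of_prods_eq {ρ ρ' : Finset ℕ} (hρ : IsIEData ρ) (hρ' : IsIEData ρ')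
    (h : ∀ S ⊆ ρ, ∃ T ⊆ ρ', ∏ r ∈ S, r = ∏ r ∈ T, r)
    (h' : ∀ T ⊆ ρ', ∃ S ⊆ ρ, ∏ r ∈ T, r = ∏ r ∈ S, r) : ρ ⊆ ρ' := by
  intro r hr
  obtain ⟨T, hT, hrT⟩ := h {r} (by simpa using hr)
  rw [prod_singleton] at hrT
  obtain ⟨t, ht⟩ : T.Nonempty := by
    rw [nonempty_iff_ne_empty]
    rintro rfl
    exact (hρ.1 r hr).ne' (by simpa using hrT)
  obtain ⟨S, hS, htS⟩ := h' {t} (by simpa using hT ht)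
  rw [prod_singleton] at htS
  have htr : t ∣ r := hrT ▸ dvd_prod_of_mem _ ht
  have hsub : S ⊆ {r} := fun s hs =>
    hρ.mem_of_dvd_prod (by simpa using hr) (hS hs)
      (by simpa using ((dvd_prod_of_mem _ hs).trans (htS ▸ htr)))
  rcases subset_singleton_iff.1 hsub with rfl | rfl
  · exact absurd (by simpa using htS) (hρ'.1 t (hT ht)).ne'
  · rw [prod_singleton] at htS
    exact htS ▸ hT ht

end IsIEData

/-- The exponents `n₀ / ∏ r ∈ S, r` over those `S ⊆ ρ` satisfying `p`. -/
def ieExponents (ρ : Finset ℕ) (p : Finset ℕ → Prop) [DecidablePred p] : Multiset ℕ :=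
  (ρ.powerset.filter p).val.map fun S => (∏ r ∈ ρ, r) / ∏ r ∈ S, r

theorem mem_ieExponents {ρ : Finset ℕ} (hρ : IsIEData ρ) {p : Finset ℕ → Prop}
    [DecidablePred p] {n : ℕ} :
    n ∈ ieExponents ρ p ↔ ∃ S ⊆ ρ, p S ∧ ∏ r ∈ ρ \ S, r = n := by
  simp only [ieExponents, Multiset.mem_map, mem_val, mem_filter, mem_powerset, and_assoc]
  refine exists_congr fun S => and_congr_right fun hS => ?_
  rw [hρ.prod_div hS]

theorem ieExponents_pos {ρ : Finset ℕ} (hρ : IsIEData ρ) {p : Finset ℕ → Prop}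
    [DecidablePred p] : ∀ n ∈ ieExponents ρ p, 0 < n := by
  intro n hn
  obtain ⟨S, -, -, rfl⟩ := (mem_ieExponents hρ).1 hn
  exact hρ.prod_pos sdiff_subset

theorem isIEPoly_iff {ρ : Finset ℕ} {Q : ℤ[X]} :
    IsIEPoly ρ Q ↔
      Q * ((ieExponents ρ fun S => Odd S.card).map fun n => X ^ n - 1).prod =
        ((ieExponents ρ fun S => Even S.card).map fun n => X ^ n - 1).prod := by
  simp only [IsIEPoly, ieExponents, Multiset.map_map, Finset.prod, Function.comp_def]

theorem disjoint_ieExponents {ρ : Finset ℕ} (hρ : IsIEData ρ) {n : ℕ}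
    (he : n ∈ ieExponents ρ fun S => Even S.card)
    (ho : n ∈ ieExponents ρ fun S => Odd S.card) : False := by
  obtain ⟨S, hS, hSe, rfl⟩ := (mem_ieExponents hρ).1 he
  obtain ⟨T, hT, hTo, hTS⟩ := (mem_ieExponents hρ).1 ho
  have h := hρ.eq_of_prod_eq sdiff_subset sdiff_subset hTS
  rw [← Finset.sdiff_sdiff_eq_self hT, h, Finset.sdiff_sdiff_eq_self hS] at hTo
  exact Nat.not_odd_iff_even.2 hSe hTo

theorem IsIEPoly.exists_prod_eq {ρ₁ ρ₂ : Finset ℕ} (h₁ : IsIEData ρ₁) (h₂ : IsIEData ρ₂)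
    {Q : ℤ[X]} (hQ₁ : IsIEPoly ρ₁ Q) (hQ₂ : IsIEPoly ρ₂ Q) :
    ∀ S ⊆ ρ₁, ∃ T ⊆ ρ₂, ∏ r ∈ S, r = ∏ r ∈ T, r := by
  rw [isIEPoly_iff] at hQ₁ hQ₂
  have key : (ieExponents ρ₁ fun S => Even S.card) + (ieExponents ρ₂ fun S => Odd S.card) =
      (ieExponents ρ₂ fun S => Even S.card) + (ieExponents ρ₁ fun S => Odd S.card) := by
    refine multiset_eq_of_prod_X_pow_sub_one_eq ?_ ?_ ?_
    · intro n hn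
      exact (Multiset.mem_add.1 hn).elim (ieExponents_pos h₁ n) (ieExponents_pos h₂ n)
    · intro n hn
      exact (Multiset.mem_add.1 hn).elim (ieExponents_pos h₂ n) (ieExponents_pos h₁ n)
    · simp only [Multiset.map_add, Multiset.prod_add]
      rw [← hQ₁, ← hQ₂]
      ring
  intro S hS
  rcases Nat.even_or_odd (ρ₁ \ S).card with hpar | hpar
  · have hn := (mem_ieExponents h₁ (p := fun S => Even S.card)).2 ⟨_, sdiff_subset, hpar, rfl⟩
    rcases Multiset.mem_add.1 (key ▸ Multiset.mem_add.2 (.inl hn)) with h | h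
    · obtain ⟨T, -, -, hT⟩ := (mem_ieExponents h₂).1 h
      exact ⟨ρ₂ \ T, sdiff_subset, by rw [hT, Finset.sdiff_sdiff_eq_self hS]⟩
    · exact (disjoint_ieExponents h₁ hn h).elim
  · have hn := (mem_ieExponents h₁ (p := fun S => Odd S.card)).2 ⟨_, sdiff_subset, hpar, rfl⟩
    rcases Multiset.mem_add.1 (key.symm ▸ Multiset.mem_add.2 (.inr hn)) with h | h
    · exact (disjoint_ieExponents h₁ h hn).elim
    · obtain ⟨T, -, -, hT⟩ := (mem_ieExponents h₂).1 h
      exact ⟨ρ₂ \ T, sdiff_subset, by rw [hT, Finset.sdiff_sdiff_eq_self hS]⟩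

/-- inclusion-exclusion polynomials determine their defining data:
`Q_{ρ₁} = Q_{ρ₂}` implies `ρ₁ = ρ₂`. -/
theorem inclusion_exclusion_poly_injective (ρ₁ ρ₂ : Finset ℕ)
    (h₁ : IsIEData ρ₁) (h₂ : IsIEData ρ₂) (Q : Polynomial ℤ)
    (hQ₁ : IsIEPoly ρ₁ Q) (hQ₂ : IsIEPoly ρ₂ Q) : ρ₁ = ρ₂ := by
  have h := IsIEPoly.exists_prod_eq h₁ h₂ hQ₁ hQ₂
  have h' := IsIEPoly.exists_prod_eq h₂ h₁ hQ₂ hQ₁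
  exact Subset.antisymm (h₁.subset_of_prods_eq h₂ h h') (h₂.subset_of_prods_eq h₁ h' h)
end

section
/- If the positive integer n has at most two distinct prime factors, then the unitary cyclotomic polynomial Φ*_n has height 1, i.e., every coefficient of Φ*_n lies in {−1, 0, 1}. -/
open Polynomial Finset

theorem unitaryGcd_eq_one_iff {n : ℕ} (hn : n ≠ 0) (j : ℕ) :
    unitaryGcd j n = 1 ↔ ∀ p ∈ n.primeFactors, ¬ p ^ n.factorization p ∣ j := by
  constructor
  · intro h p hp hdvd
    have hpp := Nat.prime_of_mem_primeFactors hp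
    have hmem : p ^ n.factorization p ∈ (unitaryDivisors n).filter fun d => d ∣ j := by
      simp only [unitaryDivisors, Finset.mem_filter, Nat.mem_divisors]
      exact ⟨⟨⟨Nat.ordProj_dvd n p, hn⟩, (Nat.coprime_ordCompl hpp hn).pow_left _⟩, hdvd⟩
    have hle : p ^ n.factorization p ≤ unitaryGcd j n := Finset.le_sup (f := id) hmem
    have hpos : n.factorization p ≠ 0 :=
      (hpp.factorization_pos_of_dvd hn (Nat.dvd_of_mem_primeFactors hp)).ne'
    have := Nat.one_lt_pow hpos hpp.one_lt
    omega
  · intro h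
    apply le_antisymm
    · refine Finset.sup_le fun d hd => ?_
      simp only [unitaryDivisors, Finset.mem_filter, Nat.mem_divisors] at hd
      obtain ⟨⟨⟨hdn, -⟩, hcop⟩, hdj⟩ := hd
      by_contra! hlt
      obtain ⟨p, hpp, hpd⟩ := Nat.exists_prime_and_dvd (n := d) (by simp at hlt; omega)
      refine h p (Nat.mem_primeFactors.2 ⟨hpp, hpd.trans hdn, hn⟩) (dvd_trans ?_ hdj)
      have hcop' : Nat.Coprime (p ^ n.factorization p) (n / d) :=
        (hcop.coprime_dvd_left hpd).pow_left _
      refine hcop'.dvd_of_dvd_mul_right ?_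
      rw [Nat.mul_div_cancel' hdn]
      exact Nat.ordProj_dvd n p
    · refine Finset.le_sup (f := id) (b := 1) ?_
      simp [unitaryDivisors, hn]

theorem prod_X_sub_exp_Icc {e : ℕ} (he : 0 < e) :
    ∏ j ∈ Finset.Icc 1 e,
      (X - C (Complex.exp (2 * (Real.pi : ℂ) * Complex.I * (j : ℂ) / (e : ℂ)))) = X ^ e - 1 := by
  have hζ := Complex.isPrimitiveRoot_exp e he.ne'
  have h := X_pow_sub_C_eq_prod hζ he hζ.pow_eq_one
  rw [C_1] at h
  rw [h, Finset.range_eq_Ico, ← Finset.Ico_add_one_right_eq_Icc,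
    ← Finset.prod_Ico_add' _ 0 e 1]
  refine Finset.prod_congr rfl fun i _ => ?_
  rw [← pow_succ, ← Complex.exp_nat_mul]
  congr 3
  push_cast
  ring

theorem prod_X_sub_exp_filter_dvd {n d e : ℕ} (hn : 0 < n) (hde : d * e = n) :
    ∏ j ∈ (Finset.Icc 1 n).filter fun j => d ∣ j,
      (X - C (Complex.exp (2 * (Real.pi : ℂ) * Complex.I * (j : ℂ) / (n : ℂ)))) = X ^ e - 1 := by
  subst hde
  have hd : 0 < d := Nat.pos_of_mul_pos_right hn
  have he : 0 < e := Nat.pos_of_mul_pos_left hn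
  rw [← prod_X_sub_exp_Icc he]
  have himg : ((Finset.Icc 1 (d * e)).filter fun j => d ∣ j) =
      (Finset.Icc 1 e).image (d * ·) := by
    ext j
    simp only [Finset.mem_filter, Finset.mem_Icc, Finset.mem_image]
    constructor
    · rintro ⟨⟨h1, h2⟩, i, rfl⟩
      exact ⟨i, ⟨Nat.pos_of_mul_pos_left h1, Nat.le_of_mul_le_mul_left h2 hd⟩, rfl⟩
    · rintro ⟨i, ⟨h1, h2⟩, rfl⟩
      exact ⟨⟨Nat.mul_pos hd h1, Nat.mul_le_mul_left d h2⟩, dvd_mul_right d i⟩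
  rw [himg, Finset.prod_image fun x _ y _ hxy => Nat.eq_of_mul_eq_mul_left hd hxy]
  refine Finset.prod_congr rfl fun i _ => ?_
  have hd' : (d : ℂ) ≠ 0 := by exact_mod_cast hd.ne'
  have he' : (e : ℂ) ≠ 0 := by exact_mod_cast he.ne'
  congr 3
  push_cast
  field_simp

/-- Inclusion-exclusion for a product over the indices avoiding two predicates. -/
theorem prod_filter_not_and_not_mul {ι M : Type*} [CommMonoid M] (s : Finset ι) (f : ι → M)
    (P Q : ι → Prop) [DecidablePred P] [DecidablePred Q] :
    (∏ j ∈ s with ¬ P j ∧ ¬ Q j, f j) * (∏ j ∈ s with P j, f j) * (∏ j ∈ s with Q j, f j) =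
      (∏ j ∈ s, f j) * ∏ j ∈ s with P j ∧ Q j, f j := by
  simp only [Finset.prod_filter, ← Finset.prod_mul_distrib]
  refine Finset.prod_congr rfl fun j _ => ?_
  by_cases hP : P j <;> by_cases hQ : Q j <;> simp [hP, hQ]

theorem pow_factorization_mul_pow_factorization {n p q : ℕ} (hn : 0 < n)
    (hs : n.primeFactors = {p, q}) (hpq : p ≠ q) :
    p ^ n.factorization p * q ^ n.factorization q = n := by
  conv_rhs => rw [← Nat.prod_factorization_pow_eq_self hn.ne']
  rw [Nat.prod_factorization_eq_prod_primeFactors, hs, Finset.prod_pair hpq]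

theorem unitaryCyclotomic_mul_of_primeFactors_pair {n p q : ℕ} (hn : 0 < n)
    (hs : n.primeFactors = {p, q}) (hpq : p ≠ q) :
    unitaryCyclotomic n * (X ^ p ^ n.factorization p - 1) * (X ^ q ^ n.factorization q - 1) =
      (X ^ n - 1) * (X - 1) := by
  have hp : p.Prime := Nat.prime_of_mem_primeFactors (n := n) (by simp [hs])
  have hq : q.Prime := Nat.prime_of_mem_primeFactors (n := n) (by simp [hs])
  have hab : p ^ n.factorization p * q ^ n.factorization q = n := pow_factorization_mul_pow_factorization hn hs hpq
  have hcop : Nat.Coprime (p ^ n.factorization p) (q ^ n.factorization q) :=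
    Nat.coprime_pow_primes _ _ hp hq hpq
  set a := p ^ n.factorization p with ha
  set b := q ^ n.factorization q with hb
  have key := prod_filter_not_and_not_mul (Finset.Icc 1 n)
    (fun j : ℕ => X - C (Complex.exp (2 * (Real.pi : ℂ) * Complex.I * (j : ℂ) / (n : ℂ))))
    (fun j => b ∣ j) (fun j => a ∣ j)
  rw [prod_X_sub_exp_filter_dvd hn hab, prod_X_sub_exp_filter_dvd hn (by rw [mul_comm, hab]),
    prod_X_sub_exp_Icc hn] at key
  have hinter : ((Finset.Icc 1 n).filter fun j => b ∣ j ∧ a ∣ j) =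
      (Finset.Icc 1 n).filter fun j => n ∣ j := by
    refine Finset.filter_congr fun j _ => ?_
    exact ⟨fun h => hab ▸ hcop.mul_dvd_of_dvd_of_dvd h.2 h.1,
      fun h => ⟨(hab ▸ dvd_mul_left b a : b ∣ n).trans h, (hab ▸ dvd_mul_right a b : a ∣ n).trans h⟩⟩
  rw [hinter, prod_X_sub_exp_filter_dvd hn (mul_one n), pow_one] at key
  rw [← key, unitaryCyclotomic]
  congr 3
  refine Finset.filter_congr fun j _ => ?_
  simp [unitaryGcd_eq_one_iff hn.ne', hs, ← ha, ← hb, and_comm]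

theorem unitaryCyclotomic_mul_of_primeFactors_singleton {n p : ℕ} (hn : 0 < n)
    (hs : n.primeFactors = {p}) :
    unitaryCyclotomic n * (X - 1) = X ^ n - 1 := by
  have ha : p ^ n.factorization p = n := by
    conv_rhs => rw [← Nat.prod_factorization_pow_eq_self hn.ne']
    rw [Nat.prod_factorization_eq_prod_primeFactors, hs, Finset.prod_singleton]
  have h1 := prod_X_sub_exp_filter_dvd hn (mul_one n)
  rw [pow_one] at h1
  rw [← prod_X_sub_exp_Icc hn, ← h1, mul_comm, unitaryCyclotomic,
    ← Finset.prod_filter_mul_prod_filter_not (Finset.Icc 1 n) (fun j => n ∣ j)]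
  congr 2
  refine Finset.filter_congr fun j _ => ?_
  simp [unitaryGcd_eq_one_iff hn.ne', hs, ha]

theorem unitaryCyclotomic_one : unitaryCyclotomic 1 = X - 1 := by
  have h := prod_X_sub_exp_Icc one_pos
  rw [pow_one] at h
  rw [← h, unitaryCyclotomic]
  congr 1

/-- `k` lies in the numerical semigroup generated by `a` and `b`, in normal form: for coprime
`a`, `b` the representation with `i < b` is unique. -/
def InSemigroup (a b k : ℕ) : Prop := ∃ i < b, ∃ j, k = a * i + b * j

theorem eq_of_mul_add_mul_eq {a b i j i' j' : ℕ} (hcop : Nat.Coprime a b) (hi : i < b)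
    (hi' : i' < b) (h : a * i + b * j = a * i' + b * j') : i = i' ∧ j = j' := by
  have hmod : a * i ≡ a * i' [MOD b] := by
    have := congrArg (· % b) h
    simpa [Nat.ModEq] using this
  have hii : i = i' :=
    (Nat.ModEq.cancel_left_of_coprime hcop.symm hmod).eq_of_lt_of_lt hi hi'
  subst hii
  exact ⟨rfl, Nat.eq_of_mul_eq_mul_left (by omega) (Nat.add_left_cancel h)⟩

open Classical in
/-- The Hilbert series of the numerical semigroup generated by `a` and `b`. -/
noncomputable def semigroupSeries (a b : ℕ) : PowerSeries ℂ :=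
  PowerSeries.mk fun k => if InSemigroup a b k then 1 else 0

theorem semigroupSeries_mul_one_sub_X_pow {a b : ℕ} (ha : 0 < a) (hcop : Nat.Coprime a b) :
    semigroupSeries a b * (1 - PowerSeries.X ^ b) =
      ∑ i ∈ Finset.range b, (PowerSeries.X ^ a) ^ i := by
  classical
  ext k
  have hsum : PowerSeries.coeff k (∑ i ∈ Finset.range b, ((PowerSeries.X : PowerSeries ℂ) ^ a) ^ i)
      = if ∃ i < b, k = a * i then 1 else 0 := by
    simp only [map_sum, ← pow_mul, PowerSeries.coeff_X_pow]
    split_ifs with h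
    · obtain ⟨i, hi, rfl⟩ := h
      rw [Finset.sum_eq_single i]
      · simp
      · intro i' _ hne
        exact if_neg fun h => hne (Nat.eq_of_mul_eq_mul_left ha h).symm
      · intro h
        exact absurd (Finset.mem_range.2 hi) h
    · push Not at h
      exact Finset.sum_eq_zero fun i hi => if_neg (h i (Finset.mem_range.1 hi))
  rw [hsum, mul_sub, mul_one, map_sub, PowerSeries.coeff_mul_X_pow']
  simp only [semigroupSeries, PowerSeries.coeff_mk]
  by_cases hk : InSemigroup a b k
  · obtain ⟨i, hi, j, rfl⟩ := hk
    have hmem : InSemigroup a b (a * i + b * j) := ⟨i, hi, j, rfl⟩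
    rcases Nat.eq_zero_or_pos j with rfl | hj
    · have hex : ∃ i' < b, a * i + b * 0 = a * i' := ⟨i, hi, by simp⟩
      rw [if_pos hmem, if_pos hex]
      split_ifs with hle hin
      · obtain ⟨i', hi', j', h⟩ := hin
        have h' : a * i + b * 0 = a * i' + b * (j' + 1) := by rw [Nat.mul_succ]; omega
        exact absurd (eq_of_mul_add_mul_eq hcop hi hi' h').2 (by omega)
      · simp
      · simp
    · obtain ⟨j, rfl⟩ := Nat.exists_eq_succ_of_ne_zero hj.ne'
      have hle : b ≤ a * i + b * j.succ := by rw [Nat.mul_succ]; omega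
      have hin : InSemigroup a b (a * i + b * j.succ - b) :=
        ⟨i, hi, j, by rw [Nat.mul_succ]; omega⟩
      have hex : ¬ ∃ i' < b, a * i + b * j.succ = a * i' := by
        rintro ⟨i', hi', h⟩
        exact absurd (eq_of_mul_add_mul_eq (j' := 0) hcop hi hi' (by simpa using h)).2 (by omega)
      rw [if_pos hmem, if_pos hle, if_pos hin, if_neg hex, sub_self]
  · have hex : ¬ ∃ i < b, k = a * i := fun ⟨i, hi, h⟩ => hk ⟨i, hi, 0, by simpa using h⟩
    rw [if_neg hk, if_neg hex]
    split_ifs with hle hin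
    · obtain ⟨i, hi, j, h⟩ := hin
      exact absurd ⟨i, hi, j + 1, by rw [Nat.mul_succ]; omega⟩ hk
    · simp
    · simp

theorem coe_eq_one_sub_X_mul_semigroupSeries {a b : ℕ} (ha : 0 < a) (hb : 0 < b)
    (hcop : Nat.Coprime a b) {F : ℂ[X]}
    (hF : F * (X ^ a - 1) * (X ^ b - 1) = (X ^ (a * b) - 1) * (X - 1)) :
    (F : PowerSeries ℂ) = semigroupSeries a b * (1 - PowerSeries.X) := by
  have hX : ∀ m : ℕ, 0 < m → (1 - PowerSeries.X ^ m : PowerSeries ℂ) ≠ 0 := by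
    intro m hm h0
    have := congrArg (PowerSeries.coeff 0) h0
    simp [hm.ne'] at this
  apply mul_right_cancel₀ (hX b hb)
  apply mul_right_cancel₀ (hX a ha)
  have hF' := congrArg (fun P : ℂ[X] => (P : PowerSeries ℂ)) hF
  simp only [Polynomial.coe_mul, Polynomial.coe_sub, Polynomial.coe_pow, Polynomial.coe_X,
    Polynomial.coe_one] at hF'
  have hgeom := geom_sum_mul ((PowerSeries.X : PowerSeries ℂ) ^ a) b
  rw [← semigroupSeries_mul_one_sub_X_pow ha hcop, ← pow_mul] at hgeom
  linear_combination hF' + (1 - PowerSeries.X) * hgeom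

theorem coeff_mem_of_mul_eq {a b : ℕ} (ha : 0 < a) (hb : 0 < b) (hcop : Nat.Coprime a b)
    {F : ℂ[X]} (hF : F * (X ^ a - 1) * (X ^ b - 1) = (X ^ (a * b) - 1) * (X - 1)) (k : ℕ) :
    F.coeff k ∈ ({-1, 0, 1} : Set ℂ) := by
  classical
  rw [← Polynomial.coeff_coe, coe_eq_one_sub_X_mul_semigroupSeries ha hb hcop hF, mul_sub,
    mul_one, map_sub]
  cases k with
  | zero =>
    simp only [semigroupSeries, PowerSeries.coeff_mk, PowerSeries.coeff_zero_mul_X]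
    split_ifs <;> simp
  | succ k =>
    simp only [semigroupSeries, PowerSeries.coeff_mk, PowerSeries.coeff_succ_mul_X]
    split_ifs <;> simp

/-- if `n` has at most two distinct prime factors, then every coefficient of
`Φ*_n` lies in `{-1, 0, 1}` (i.e. `Φ*_n` has height `1`). -/
theorem unitaryCyclotomic_height_one (n : ℕ) (hn : 0 < n)
    (h : n.primeFactors.card ≤ 2) (k : ℕ) :
    (unitaryCyclotomic n).coeff k ∈ ({-1, 0, 1} : Set ℂ) := by
  rcases Nat.lt_or_ge n.primeFactors.card 1 with h0 | h1
  · have hempty : n.primeFactors = ∅ := Finset.card_eq_zero.1 (by omega)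
    obtain rfl : n = 1 := by
      rcases Nat.primeFactors_eq_empty.1 hempty with h | h <;> omega
    rw [unitaryCyclotomic_one, coeff_sub, coeff_X, coeff_one]
    split_ifs <;> simp
  · rcases h1.eq_or_lt with h1 | h2
    · obtain ⟨p, hs⟩ := Finset.card_eq_one.1 h1.symm
      have hF : unitaryCyclotomic n = ∑ i ∈ Finset.range n, X ^ i := by
        apply mul_right_cancel₀ (X_sub_C_ne_zero (1 : ℂ))
        rw [C_1, unitaryCyclotomic_mul_of_primeFactors_singleton hn hs, geom_sum_mul]
      rw [hF]
      simp only [finsetSum_coeff, coeff_X_pow, Finset.sum_ite_eq]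
      split_ifs <;> simp
    · obtain ⟨p, q, hpq, hs⟩ := Finset.card_eq_two.1 (le_antisymm h h2)
      have hp : p.Prime := Nat.prime_of_mem_primeFactors (n := n) (by simp [hs])
      have hq : q.Prime := Nat.prime_of_mem_primeFactors (n := n) (by simp [hs])
      refine coeff_mem_of_mul_eq (pow_pos hp.pos (n.factorization p))
        (pow_pos hq.pos (n.factorization q)) (Nat.coprime_pow_primes _ _ hp hq hpq) ?_ k
      rw [pow_factorization_mul_pow_factorization hn hs hpq]
      exact unitaryCyclotomic_mul_of_primeFactors_pair hn hs hpq
end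

section
/- For all positive integers n and k: c*_n(k) = ∑_{d ∣ n, κ(d) = κ(n)} c_d(k), and c_n(k) = ∑_{d ∣ n, κ(d) = κ(n)} c*_d(k) μ(n/d), where μ is the Möbius function and the sums run over all positive divisors d of n whose squarefree kernel equals that of n. -/
open Polynomial Finset

theorem kernel_eq_kernel_iff {m n : ℕ} : kernel m = kernel n ↔ m.primeFactors = n.primeFactors := by
  refine ⟨fun h => ?_, fun h => by rw [kernel, kernel, h]⟩
  rw [← Nat.primeFactors_prod_primeFactors m, ← Nat.primeFactors_prod_primeFactors n]
  exact congrArg Nat.primeFactors h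

theorem unitaryGcd_eq_one_iff_forall {j n : ℕ} (hn : n ≠ 0) :
    unitaryGcd j n = 1 ↔ ∀ d, d ∣ n → Nat.Coprime d (n / d) → d ∣ j → d = 1 := by
  have hone : 1 ∈ (unitaryDivisors n).filter fun d => d ∣ j := by
    simp [unitaryDivisors, hn]
  constructor
  · intro h d hd hc hj
    have hle : d ≤ unitaryGcd j n :=
      Finset.le_sup (f := id) (Finset.mem_filter.2
        ⟨Finset.mem_filter.2 ⟨Nat.mem_divisors.2 ⟨hd, hn⟩, hc⟩, hj⟩)
    have := Nat.pos_of_dvd_of_pos hd (Nat.pos_of_ne_zero hn)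
    omega
  · intro h
    refine le_antisymm (Finset.sup_le fun d hd => ?_) (Finset.le_sup (f := id) hone)
    simp only [unitaryDivisors, Finset.mem_filter, Nat.mem_divisors] at hd
    exact (h d hd.1.1.1 hd.1.2 hd.2).le

theorem unitaryGcd_eq_one_iff_kernel {j n : ℕ} (hn : n ≠ 0) :
    unitaryGcd j n = 1 ↔ kernel (n / n.gcd j) = kernel n := by
  have hg : n.gcd j ∣ n := Nat.gcd_dvd_left n j
  have hmul : n / n.gcd j * n.gcd j = n := Nat.div_mul_cancel hg
  rw [unitaryGcd_eq_one_iff_forall hn, kernel_eq_kernel_iff]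
  constructor
  · intro h
    refine (Nat.primeFactors_mono (Nat.div_dvd_of_dvd hg) hn).antisymm fun p hp => ?_
    have hpp := Nat.prime_of_mem_primeFactors hp
    have hpn := Nat.dvd_of_mem_primeFactors hp
    refine Nat.mem_primeFactors.2 ⟨hpp, ?_, fun h0 => hn (by rw [← hmul, h0, zero_mul])⟩
    by_contra hnd
    have hco : Nat.Coprime (p ^ n.factorization p) (n / n.gcd j) :=
      Nat.Coprime.pow_left _ ((Nat.Prime.coprime_iff_not_dvd hpp).2 hnd)
    have hdvd : p ^ n.factorization p ∣ n.gcd j :=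
      hco.dvd_of_dvd_mul_left (hmul.symm ▸ Nat.ordProj_dvd n p)
    have h1 := h _ (Nat.ordProj_dvd n p)
      (Nat.Coprime.pow_left _ (Nat.coprime_ordCompl hpp hn)) (hdvd.trans (Nat.gcd_dvd_right n j))
    have hp1 : p ∣ p ^ n.factorization p :=
      dvd_pow_self p (hpp.factorization_pos_of_dvd hn hpn).ne'
    exact hpp.one_lt.ne' (Nat.dvd_one.1 (h1 ▸ hp1))
  · intro h d hd hc hj
    by_contra hd1
    obtain ⟨p, hpp, hpd⟩ := Nat.exists_prime_and_dvd hd1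
    have hp : p ∈ (n / n.gcd j).primeFactors :=
      h ▸ Nat.mem_primeFactors.2 ⟨hpp, hpd.trans hd, hn⟩
    have hquot : n / n.gcd j ∣ n / d := Nat.div_dvd_div_left hg (Nat.dvd_gcd hd hj)
    exact Nat.not_coprime_of_dvd_of_dvd hpp.one_lt hpd
      ((Nat.dvd_of_mem_primeFactors hp).trans hquot) hc

/-- The Ramanujan sum of a divisor `d` of `n`, over the fractions `j / n` of exact denominator `d`. -/
theorem sum_filter_div_gcd_eq_ramanujanSum {d n : ℕ} (hn : n ≠ 0) (hd : d ∣ n) (k : ℕ) :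
    ∑ j ∈ (Finset.Icc 1 n).filter fun j => n / n.gcd j = d,
      Complex.exp (2 * (Real.pi : ℂ) * Complex.I * (j : ℂ) * (k : ℂ) / (n : ℂ)) =
    ramanujanSum d k := by
  obtain ⟨e, rfl⟩ := hd
  have hd0 : 0 < d := Nat.pos_of_ne_zero (left_ne_zero_of_mul hn)
  have he0 : 0 < e := Nat.pos_of_ne_zero (right_ne_zero_of_mul hn)
  symm
  refine Finset.sum_bij (fun i _ => i * e) ?_ ?_ ?_ ?_
  · intro i hi
    simp only [Finset.mem_filter, Finset.mem_Icc] at hi ⊢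
    refine ⟨⟨Nat.mul_pos hi.1.1 he0, Nat.mul_le_mul_right e hi.1.2⟩, ?_⟩
    rw [Nat.gcd_mul_right, hi.2.symm.gcd_eq_one, one_mul, Nat.mul_div_cancel _ he0]
  · intro a _ b _ h
    exact Nat.eq_of_mul_eq_mul_right he0 h
  · intro j hj
    simp only [Finset.mem_filter, Finset.mem_Icc] at hj
    obtain ⟨⟨hj1, hj2⟩, hj3⟩ := hj
    have hg : (d * e).gcd j = e := by
      have h := Nat.div_mul_cancel (Nat.gcd_dvd_left (d * e) j)
      rw [hj3] at h
      exact Nat.eq_of_mul_eq_mul_left hd0 h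
    obtain ⟨i, rfl⟩ : e ∣ j := hg ▸ Nat.gcd_dvd_right (d * e) j
    rw [mul_comm e i] at hj1 hj2 hg ⊢
    refine ⟨i, ?_, rfl⟩
    simp only [Finset.mem_filter, Finset.mem_Icc]
    refine ⟨⟨Nat.pos_of_mul_pos_right hj1, Nat.le_of_mul_le_mul_right hj2 he0⟩, ?_⟩
    rw [Nat.gcd_mul_right] at hg
    exact Nat.Coprime.symm (Nat.eq_of_mul_eq_mul_right he0 (hg.trans (one_mul e).symm))
  · intro i _
    have he : (e : ℂ) ≠ 0 := Nat.cast_ne_zero.2 he0.ne'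
    have hdc : (d : ℂ) ≠ 0 := Nat.cast_ne_zero.2 hd0.ne'
    congr 1
    push_cast
    field_simp

theorem unitaryRamanujan_eq_sum_divisors {n : ℕ} (hn : n ≠ 0) (k : ℕ) :
    unitaryRamanujan n k =
      ∑ d ∈ n.divisors.filter fun d => kernel d = kernel n, ramanujanSum d k := by
  rw [unitaryRamanujan, ← Finset.sum_fiberwise_of_maps_to (g := fun j => n / n.gcd j)
    (t := n.divisors.filter fun d => kernel d = kernel n)]
  · refine Finset.sum_congr rfl fun d hd => ?_
    simp only [Finset.mem_filter, Nat.mem_divisors] at hd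
    rw [← sum_filter_div_gcd_eq_ramanujanSum hn hd.1.1, Finset.filter_filter]
    refine Finset.sum_congr (Finset.filter_congr fun j _ => ?_) fun _ _ => rfl
    rw [unitaryGcd_eq_one_iff_kernel hn]
    exact ⟨And.right, fun h => ⟨h ▸ hd.2, h⟩⟩
  · intro j hj
    rw [Finset.mem_filter, unitaryGcd_eq_one_iff_kernel hn] at hj
    exact Finset.mem_filter.2
      ⟨Nat.mem_divisors.2 ⟨Nat.div_dvd_of_dvd (Nat.gcd_dvd_left n j), hn⟩, hj.2⟩

theorem kernel_eq_of_dvd_of_dvd {d m n : ℕ} (hn : n ≠ 0) (hdm : d ∣ m) (hmn : m ∣ n)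
    (h : kernel d = kernel n) : kernel m = kernel n := by
  rw [kernel_eq_kernel_iff] at h ⊢
  exact (Nat.primeFactors_mono hmn hn).antisymm
    (h ▸ Nat.primeFactors_mono hdm (ne_zero_of_dvd_ne_zero hn hmn))

theorem ramanujanSum_eq_sum_divisors {n : ℕ} (hn : n ≠ 0) (k : ℕ) :
    ramanujanSum n k =
      ∑ d ∈ n.divisors.filter fun d => kernel d = kernel n,
        unitaryRamanujan d k * ((ArithmeticFunction.moebius (n / d) : ℤ) : ℂ) := by
  have key := (ArithmeticFunction.sum_eq_iff_sum_mul_moebius_eq_on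
    (f := fun m => if kernel m = kernel n then ramanujanSum m k else 0)
    (g := fun m => if kernel m = kernel n then unitaryRamanujan m k else 0)
    {m | m ∣ n} fun _ _ h h' => h.trans h').1 ?_ n (Nat.pos_of_ne_zero hn) dvd_rfl
  · rw [if_pos rfl] at key
    rw [← key, Nat.sum_divisorsAntidiagonal'
      (fun a b => ((ArithmeticFunction.moebius a : ℤ) : ℂ) *
        if kernel b = kernel n then unitaryRamanujan b k else 0), Finset.sum_filter]
    refine Finset.sum_congr rfl fun d _ => ?_
    split_ifs
    · exact mul_comm _ _
    · exact mul_zero _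
  · intro m hm hmn
    rw [← Finset.sum_filter]
    split_ifs with h
    · rw [unitaryRamanujan_eq_sum_divisors hm.ne', h]
    · rw [Finset.filter_false_of_mem, Finset.sum_empty]
      exact fun d hd hdn => h (kernel_eq_of_dvd_of_dvd hn (Nat.dvd_of_mem_divisors hd) hmn hdn)

/-- `c*_n(k) = ∑_{d ∣ n, κ(d) = κ(n)} c_d(k)` and
`c_n(k) = ∑_{d ∣ n, κ(d) = κ(n)} c*_d(k) μ(n/d)`. -/
theorem unitaryRamanujan_eq_sum_ramanujan (n k : ℕ) (hn : 0 < n) (hk : 0 < k) :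
    (unitaryRamanujan n k =
      ∑ d ∈ n.divisors.filter fun d => kernel d = kernel n, ramanujanSum d k) ∧
    (ramanujanSum n k =
      ∑ d ∈ n.divisors.filter fun d => kernel d = kernel n,
        unitaryRamanujan d k * ((ArithmeticFunction.moebius (n / d) : ℤ) : ℂ)) := by
  exact ⟨unitaryRamanujan_eq_sum_divisors hn.ne' k, ramanujanSum_eq_sum_divisors hn.ne' k⟩
end
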